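/- Let X1, X2 be smooth vector fields on an open set U ⊆ ℝ², forming a basis of ℝ² at every point, with [X2, X1] = X1 at every point (so the structure functions are the constants c1 = −1, c2 = 0). Let a, b, c, d be real numbers with ad − bc ≠ 0, and let g be a smooth assignment of symmetric bilinear forms with constant values g(X1,X1) = c² − a², g(X1,X2) = g(X2,X1) = cd − ab, g(X2,X2) = d² − b² on the frame. Let D be a Levi-Civita connection for g and R_{XY}Z = D_{[X,Y]}Z − D_X D_Y Z + D_Y D_X Z. Then the sectional curvature K = g(R_{X1 X2}X1, X2)/(g(X1,X1)·g(X2,X2) − g(X1,X2)²) is identically equal to (c² − a²)/(ad − bc)². (Here g(X1,X1)·g(X2,X2) − g(X1,X2)² = −(ad − bc)² ≠ 0, so g is Lorentzian.) -/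

import Mathlib

noncomputable section

/-- Points of the plane. -/
abbrev Pt : Type := ℝ × ℝ

/-- Vector fields on (an open subset of) the plane, given as maps `ℝ² → ℝ²`. -/
abbrev VF : Type := Pt → Pt

/-- The Lie bracket of vector fields: `[V,W](q) = DW(q)(V(q)) − DV(q)(W(q))`. -/
def vbracket (V W : VF) : VF :=
  fun q => fderiv ℝ W q (V q) - fderiv ℝ V q (W q)

/-- Directional derivative of a function `f` along the vector field `X`. -/
def dirDeriv (X : VF) (f : Pt → ℝ) : Pt → ℝ :=
  fun q => fderiv ℝ f q (X q)

/-- `g` assigns to each point of `U` a symmetric bilinear form on `ℝ²`, smoothly in the point. -/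
structure SmoothSymmBilin (U : Set Pt) (g : Pt → Pt → Pt → ℝ) : Prop where
  symm : ∀ q ∈ U, ∀ v w : Pt, g q v w = g q w v
  add_left : ∀ q ∈ U, ∀ u v w : Pt, g q (u + v) w = g q u w + g q v w
  smul_left : ∀ q ∈ U, ∀ (r : ℝ) (v w : Pt), g q (r • v) w = r * g q v w
  add_right : ∀ q ∈ U, ∀ u v w : Pt, g q u (v + w) = g q u v + g q u w
  smul_right : ∀ q ∈ U, ∀ (r : ℝ) (v w : Pt), g q v (r • w) = r * g q v w
  smooth : ∀ v w : Pt, ContDiffOn ℝ (⊤ : ℕ∞) (fun q => g q v w) U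

/-- A Levi-Civita connection for `g` on `U`: it sends pairs of smooth vector fields to a
smooth vector field, is `C^∞(U)`-linear in the first argument, `ℝ`-linear in the second,
satisfies the Leibniz rule, is torsion-free and metric-compatible. -/
structure IsLeviCivita (U : Set Pt) (g : Pt → Pt → Pt → ℝ) (D : VF → VF → VF) : Prop where
  smooth : ∀ V W : VF, ContDiffOn ℝ (⊤ : ℕ∞) V U → ContDiffOn ℝ (⊤ : ℕ∞) W U →
    ContDiffOn ℝ (⊤ : ℕ∞) (D V W) U
  add_fst : ∀ V V' W : VF, ContDiffOn ℝ (⊤ : ℕ∞) V U → ContDiffOn ℝ (⊤ : ℕ∞) V' U →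
    ContDiffOn ℝ (⊤ : ℕ∞) W U → ∀ q ∈ U, D (V + V') W q = D V W q + D V' W q
  smul_fst : ∀ (f : Pt → ℝ) (V W : VF), ContDiffOn ℝ (⊤ : ℕ∞) f U →
    ContDiffOn ℝ (⊤ : ℕ∞) V U → ContDiffOn ℝ (⊤ : ℕ∞) W U →
    ∀ q ∈ U, D (fun p => f p • V p) W q = f q • D V W q
  add_snd : ∀ V W W' : VF, ContDiffOn ℝ (⊤ : ℕ∞) V U → ContDiffOn ℝ (⊤ : ℕ∞) W U →
    ContDiffOn ℝ (⊤ : ℕ∞) W' U → ∀ q ∈ U, D V (W + W') q = D V W q + D V W' q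
  smul_snd : ∀ (r : ℝ) (V W : VF), ContDiffOn ℝ (⊤ : ℕ∞) V U →
    ContDiffOn ℝ (⊤ : ℕ∞) W U → ∀ q ∈ U, D V (r • W) q = r • D V W q
  leibniz : ∀ (f : Pt → ℝ) (V W : VF), ContDiffOn ℝ (⊤ : ℕ∞) f U →
    ContDiffOn ℝ (⊤ : ℕ∞) V U → ContDiffOn ℝ (⊤ : ℕ∞) W U →
    ∀ q ∈ U, D V (fun p => f p • W p) q = fderiv ℝ f q (V q) • W q + f q • D V W q
  torsion_free : ∀ V W : VF, ContDiffOn ℝ (⊤ : ℕ∞) V U → ContDiffOn ℝ (⊤ : ℕ∞) W U →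
    ∀ q ∈ U, D V W q - D W V q = vbracket V W q
  compat : ∀ X V W : VF, ContDiffOn ℝ (⊤ : ℕ∞) X U → ContDiffOn ℝ (⊤ : ℕ∞) V U →
    ContDiffOn ℝ (⊤ : ℕ∞) W U →
    ∀ q ∈ U, fderiv ℝ (fun p => g p (V p) (W p)) q (X q)
      = g q (D X V q) (W q) + g q (V q) (D X W q)

/-- Two linearly independent vectors of the plane span it. -/
theorem exists_eq_smul_add_smul {v w : Pt} (h : LinearIndependent ℝ ![v, w]) (u : Pt) :
    ∃ x y : ℝ, u = x • v + y • w := by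
  have hspan := h.span_eq_top_of_card_eq_finrank (by simp)
  have hu : u ∈ Submodule.span ℝ (Set.range ![v, w]) := hspan ▸ Submodule.mem_top
  rw [Matrix.range_cons_cons_empty, Submodule.mem_span_pair] at hu
  obtain ⟨x, y, h⟩ := hu
  exact ⟨x, y, h.symm⟩

theorem vbracket_swap (V W : VF) (q : Pt) : vbracket V W q = -vbracket W V q := by
  simp [vbracket]

namespace IsLeviCivita

variable {U : Set Pt} {g : Pt → Pt → Pt → ℝ} {D : VF → VF → VF}

/-- `D Z W` vanishes on `U` when `Z` does. -/
theorem eq_zero_of_eqOn_zero (hD : IsLeviCivita U g D) {Z W : VF} (hZ : ∀ q ∈ U, Z q = 0)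
    (hW : ContDiffOn ℝ (⊤ : ℕ∞) W U) {q : Pt} (hq : q ∈ U) : D Z W q = 0 := by
  have hf : ContDiffOn ℝ (⊤ : ℕ∞) (Set.indicator Uᶜ fun _ => (1 : ℝ)) U :=
    (contDiffOn_const (c := 0)).congr fun p hp => by simp [hp]
  have hZs : ContDiffOn ℝ (⊤ : ℕ∞) Z U := contDiffOn_const.congr hZ
  have hfZ : (fun p => Set.indicator Uᶜ (fun _ => (1 : ℝ)) p • Z p) = Z := by
    funext p
    by_cases hp : p ∈ U <;> simp [hp, hZ]
  have h := hD.smul_fst _ Z W hf hZs hW q hq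
  rw [hfZ] at h
  simpa [hq] using h

/-- If `V = -X` on `U`, then `D V W = -D X W` on `U`. -/
theorem eq_neg_of_eqOn_neg (hD : IsLeviCivita U g D) {V X W : VF} (hV : ∀ q ∈ U, V q = -X q)
    (hX : ContDiffOn ℝ (⊤ : ℕ∞) X U) (hW : ContDiffOn ℝ (⊤ : ℕ∞) W U) {q : Pt} (hq : q ∈ U) :
    D V W q = -D X W q := by
  have h := hD.add_fst V X W (hX.neg.congr hV) hX hW q hq
  rw [hD.eq_zero_of_eqOn_zero (fun p hp => by simp [hV p hp]) hW hq] at h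
  exact eq_neg_of_add_eq_zero_left h.symm

/-- Metric compatibility for a pair of fields whose product is constant on `U`. -/
theorem compat_of_eqOn_const (hD : IsLeviCivita U g D) (hU : IsOpen U) {X V W : VF}
    (hX : ContDiffOn ℝ (⊤ : ℕ∞) X U) (hV : ContDiffOn ℝ (⊤ : ℕ∞) V U)
    (hW : ContDiffOn ℝ (⊤ : ℕ∞) W U) {k : ℝ} (hk : ∀ q ∈ U, g q (V q) (W q) = k)
    {q : Pt} (hq : q ∈ U) : g q (D X V q) (W q) + g q (V q) (D X W q) = 0 := by
  have he : (fun p => g p (V p) (W p)) =ᶠ[nhds q] fun _ => k :=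
    Filter.eventuallyEq_of_mem (hU.mem_nhds hq) hk
  rw [← hD.compat X V W hX hV hW q hq, he.fderiv_eq]
  simp

end IsLeviCivita

theorem sectional_curvature_left_invariant
    (U : Set Pt) (hU : IsOpen U)
    (X1 X2 : VF)
    (hX1 : ContDiffOn ℝ (⊤ : ℕ∞) X1 U) (hX2 : ContDiffOn ℝ (⊤ : ℕ∞) X2 U)
    (hbasis : ∀ q ∈ U, LinearIndependent ℝ ![X1 q, X2 q])
    (hbr : ∀ q ∈ U, vbracket X2 X1 q = X1 q)
    (a b c d : ℝ) (hdet : a * d - b * c ≠ 0)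
    (g : Pt → Pt → Pt → ℝ) (hg : SmoothSymmBilin U g)
    (h11 : ∀ q ∈ U, g q (X1 q) (X1 q) = c ^ 2 - a ^ 2)
    (h12 : ∀ q ∈ U, g q (X1 q) (X2 q) = c * d - a * b)
    (h22 : ∀ q ∈ U, g q (X2 q) (X2 q) = d ^ 2 - b ^ 2)
    (D : VF → VF → VF) (hD : IsLeviCivita U g D)
    (R : VF)
    (hR : ∀ q : Pt, R q =
      D (vbracket X1 X2) X1 q - D X1 (D X2 X1) q + D X2 (D X1 X1) q)
    (K : Pt → ℝ)
    (hK : ∀ q ∈ U, K q = g q (R q) (X2 q) /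
      ((c ^ 2 - a ^ 2) * (d ^ 2 - b ^ 2) - (c * d - a * b) ^ 2)) :
    ∀ q ∈ U, K q = (c ^ 2 - a ^ 2) / (a * d - b * c) ^ 2 := by
  have half : ∀ {V W : VF} {k : ℝ}, ContDiffOn ℝ (⊤ : ℕ∞) V U → ContDiffOn ℝ (⊤ : ℕ∞) W U →
      (∀ q ∈ U, g q (W q) (W q) = k) → ∀ q ∈ U, g q (D V W q) (W q) = 0 := by
    intro V W k hV hW hk q hq
    have h := hD.compat_of_eqOn_const hU hV hW hW hk hq
    rw [hg.symm q hq (W q)] at h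
    linarith
  have hD12 : ∀ q ∈ U, D X2 X1 q = D X1 X2 q + X1 q := fun q hq => by
    rw [← hbr q hq, ← hD.torsion_free X2 X1 hX2 hX1 q hq]
    abel
  have g111 := half hX1 hX1 h11
  have g211 := half hX2 hX1 h11
  have g122 := half hX1 hX2 h22
  have g222 := half hX2 hX2 h22
  have g212 : ∀ q ∈ U, g q (D X2 X1 q) (X2 q) = c * d - a * b := fun q hq => by
    rw [hD12 q hq, hg.add_left q hq, g122 q hq, h12 q hq, zero_add]
  have g121 : ∀ q ∈ U, g q (D X1 X2 q) (X1 q) = -(c ^ 2 - a ^ 2) := fun q hq => by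
    have h := g211 q hq
    rw [hD12 q hq, hg.add_left q hq, h11 q hq] at h
    linarith
  have g112 : ∀ q ∈ U, g q (D X1 X1 q) (X2 q) = c ^ 2 - a ^ 2 := fun q hq => by
    have h := hD.compat_of_eqOn_const hU hX1 hX1 hX2 h12 hq
    rw [hg.symm q hq (X1 q), g121 q hq] at h
    linarith
  have g221 : ∀ q ∈ U, g q (D X2 X2 q) (X1 q) = -(c * d - a * b) := fun q hq => by
    have h := hD.compat_of_eqOn_const hU hX2 hX1 hX2 h12 hq
    rw [hg.symm q hq (X1 q), g212 q hq] at h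
    linarith
  intro q hq
  have k1 := hD.compat_of_eqOn_const hU hX1 (hD.smooth X2 X1 hX2 hX1) hX2 g212 hq
  have k2 := hD.compat_of_eqOn_const hU hX2 (hD.smooth X1 X1 hX1 hX1) hX2 g112 hq
  have hneg : D (vbracket X1 X2) X1 q = -D X1 X1 q :=
    hD.eq_neg_of_eqOn_neg (fun p hp => by rw [vbracket_swap, hbr p hp]) hX1 hX1 hq
  have hRq : g q (R q) (X2 q) = -(c ^ 2 - a ^ 2) + g q (D X2 X1 q) (D X1 X2 q)
      - g q (D X1 X1 q) (D X2 X2 q) := by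
    have e : R q = (-1 : ℝ) • D X1 X1 q + (-1 : ℝ) • D X1 (D X2 X1) q + D X2 (D X1 X1) q := by
      rw [hR, hneg]
      module
    rw [e, hg.add_left q hq, hg.add_left q hq, hg.smul_left q hq, hg.smul_left q hq, g112 q hq]
    linarith
  have hcomb : ∀ (x y : ℝ) (v : Pt), g q (x • X1 q + y • X2 q) v
      = x * g q v (X1 q) + y * g q v (X2 q) := fun x y v => by
    rw [hg.add_left q hq, hg.smul_left q hq, hg.smul_left q hq, hg.symm q hq (X1 q),
      hg.symm q hq (X2 q)]
  have h21 : g q (X2 q) (X1 q) = c * d - a * b := by rw [hg.symm q hq, h12 q hq]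
  obtain ⟨x, y, hu⟩ := exists_eq_smul_add_smul (hbasis q hq) (D X2 X1 q)
  obtain ⟨x', y', hw⟩ := exists_eq_smul_add_smul (hbasis q hq) (D X1 X1 q)
  have u1 := g211 q hq
  have u2 := g212 q hq
  have w1 := g111 q hq
  have w2 := g112 q hq
  rw [hu, hcomb, h11 q hq, h12 q hq] at u1
  rw [hu, hcomb, h21, h22 q hq] at u2
  rw [hw, hcomb, h11 q hq, h12 q hq] at w1
  rw [hw, hcomb, h21, h22 q hq] at w2
  rw [hu, hw, hcomb, hcomb, g121 q hq, g122 q hq, g221 q hq, g222 q hq] at hRq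
  have hΔ : (c ^ 2 - a ^ 2) * (d ^ 2 - b ^ 2) - (c * d - a * b) ^ 2 = -(a * d - b * c) ^ 2 := by
    ring
  have hx : x * (a * d - b * c) ^ 2 = (c * d - a * b) ^ 2 := by
    linear_combination -(d ^ 2 - b ^ 2) * u1 + (c * d - a * b) * u2
  have hx' : x' * (a * d - b * c) ^ 2 = (c * d - a * b) * (c ^ 2 - a ^ 2) := by
    linear_combination -(d ^ 2 - b ^ 2) * w1 + (c * d - a * b) * w2
  have hcancel : x * (c ^ 2 - a ^ 2) = x' * (c * d - a * b) := by
    apply mul_right_cancel₀ (pow_ne_zero 2 hdet)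
    linear_combination (c ^ 2 - a ^ 2) * hx - (c * d - a * b) * hx'
  have hgR : g q (R q) (X2 q) = -(c ^ 2 - a ^ 2) := by
    linear_combination hRq - hcancel
  rw [hK q hq, hgR, hΔ, neg_div_neg_eq]
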